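/- Let Ω be a bounded open set in ℝ^d, T > 0, 1 ≤ p, q < ∞, and let exponents satisfy 1/p₁ + 1/p₂ = 1/r₁ + 1/r₂ = 1/p, 1/q₁ + 1/q₂ = 1/q, and set 1/s = 1/s₁ + 1/s₂. Suppose g ∈ L^{q₁,p₁}(ℝ^{d+1}; L^{s₁,r₁}) and f ∈ L^{q₂,p₂}(ℝ^{d+1}; L^{s₂,r₂}) are measurable functions of (x,t;y,τ), 1-periodic in (y,τ). If s ≥ max{p,q}, then for every ε > 0, ‖[S_ε(g)·S_ε(f)]^ε‖_{L^{q,p}(Ω_T∖Ω_T^{1,ε})} ≤ C ‖g‖_{L^{q₁,p₁}(Ω_T; L^{s₁,r₁})} ‖f‖_{L^{q₂,p₂}(Ω_T; L^{s₂,r₂})}, where C depends only on d. In particular, taking f ≡ 1 on Ω_T, for s ≥ max{p,q} one has ‖[S_ε(g)]^ε‖_{L^{q,p}(Ω_T∖Ω_T^{1,ε})} ≤ C ‖g‖_{L^{q,p}(Ω_T; L^{s,p})}. -/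

import Mathlib

open MeasureTheory ENNReal Set

noncomputable section

abbrev Esp (d : ℕ) : Type := EuclideanSpace ℝ (Fin d)

/-- `L^p` "norm" (in `ℝ≥0∞`) of an `ℝ≥0∞`-valued function, essential-sup for `p = ∞`. -/
def eLp {α : Type*} [MeasurableSpace α] (p : ℝ≥0∞) (μ : Measure α) (f : α → ℝ≥0∞) : ℝ≥0∞ :=
  if p = ∞ then essSup f μ else (∫⁻ x, f x ^ p.toReal ∂μ) ^ (1 / p.toReal)

/-- Unit periodicity cell `[0,1]^d`. -/
def unitCell (d : ℕ) : Set (Esp d) := {y | ∀ i, y i ∈ Icc (0:ℝ) 1}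

/-- `L^{s,r}` norm over the unit periodicity cell (`τ` outer, `y` inner);
`s = r = ∞` gives the essential supremum over the cell. -/
def cellNorm {d : ℕ} (s r : ℝ≥0∞) (g : Esp d → ℝ → ℝ) : ℝ≥0∞ :=
  eLp s (volume.restrict (Ioc (0:ℝ) 1)) fun τ =>
    eLp r (volume.restrict (unitCell d)) fun y => (‖g y τ‖₊ : ℝ≥0∞)

/-- Mixed `L^{q,p}` norm (`t` outer, `x` inner) over a space-time region `A`. -/
def mixNorm {d : ℕ} (q p : ℝ≥0∞) (A : Set (Esp d × ℝ)) (F : Esp d → ℝ → ℝ≥0∞) : ℝ≥0∞ :=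
  eLp q volume fun t => eLp p (volume.restrict {x | (x, t) ∈ A}) fun x => F x t

/-- 1-periodicity in the microscopic variables `(y,τ)`. -/
def Per4 {d : ℕ} (g : Esp d → ℝ → Esp d → ℝ → ℝ) : Prop :=
  ∀ x t y τ, (∀ i, g x t (y + EuclideanSpace.single i 1) τ = g x t y τ) ∧
    g x t y (τ + 1) = g x t y τ

def Meas4 {d : ℕ} (g : Esp d → ℝ → Esp d → ℝ → ℝ) : Prop :=
  Measurable fun w : (Esp d × ℝ) × Esp d × ℝ => g w.1.1 w.1.2 w.2.1 w.2.2

/-- Time smoothing `S^t_ε` of a four-variable function. -/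
def St4 {d : ℕ} (φ₁ : ℝ → ℝ) (ε : ℝ) (g : Esp d → ℝ → Esp d → ℝ → ℝ) :
    Esp d → ℝ → Esp d → ℝ → ℝ :=
  fun x t y τ => ∫ s : ℝ, g x (t - s) y τ * ((ε ^ 2)⁻¹ * φ₁ (s / ε ^ 2))

/-- Space smoothing `S^x_ε` of a four-variable function. -/
def Sx4 {d : ℕ} (φ₂ : Esp d → ℝ) (ε : ℝ) (g : Esp d → ℝ → Esp d → ℝ → ℝ) :
    Esp d → ℝ → Esp d → ℝ → ℝ :=
  fun x t y τ => ∫ z : Esp d, g (x - z) t y τ * ((ε ^ d)⁻¹ * φ₂ (ε⁻¹ • z))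

/-- `S_ε = S^t_ε ∘ S^x_ε`. -/
def S4 {d : ℕ} (φ₁ : ℝ → ℝ) (φ₂ : Esp d → ℝ) (ε : ℝ) (g : Esp d → ℝ → Esp d → ℝ → ℝ) :
    Esp d → ℝ → Esp d → ℝ → ℝ :=
  St4 φ₁ ε (Sx4 φ₂ ε g)

/-- `g^ε(x,t) := g(x,t; x/ε, t/ε²)`. -/
def osc4 {d : ℕ} (ε : ℝ) (g : Esp d → ℝ → Esp d → ℝ → ℝ) : Esp d → ℝ → ℝ :=
  fun x t => g x t (ε⁻¹ • x) (t / ε ^ 2)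

/-- Smooth nonnegative normalized kernel supported in `(-1/2,1/2)`. -/
def GoodK1 (φ₁ : ℝ → ℝ) : Prop :=
  ContDiff ℝ (⊤ : ℕ∞) φ₁ ∧ HasCompactSupport φ₁ ∧ tsupport φ₁ ⊆ Ioo (-(1/2) : ℝ) (1/2) ∧
    (∀ s, 0 ≤ φ₁ s) ∧ (∫ s : ℝ, φ₁ s) = 1

/-- Smooth nonnegative normalized kernel supported in the ball `B(0,1/2) ⊆ ℝ^d`. -/
def GoodK2 {d : ℕ} (φ₂ : Esp d → ℝ) : Prop :=
  ContDiff ℝ (⊤ : ℕ∞) φ₂ ∧ HasCompactSupport φ₂ ∧ tsupport φ₂ ⊆ Metric.ball (0 : Esp d) (1/2) ∧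
    (∀ z, 0 ≤ φ₂ z) ∧ (∫ z : Esp d, φ₂ z) = 1

/-- `Ω_T = Ω × (0,T)`. -/
def timeSpace {d : ℕ} (Ω : Set (Esp d)) (T : ℝ) : Set (Esp d × ℝ) := Ω ×ˢ Ioo 0 T

/-- The boundary layer `Ω_T^{k,ε}`. -/
def blayer {d : ℕ} (Ω : Set (Esp d)) (T k ε : ℝ) : Set (Esp d × ℝ) :=
  ({x ∈ Ω | Metric.infDist x Ωᶜ < k * ε} ×ˢ Ioo 0 T) ∪ (Ω ×ˢ Ioo 0 (k * ε ^ 2)) ∪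
    (Ω ×ˢ Ioo (T - k * ε ^ 2) T)

section LpToolkit

variable {α β : Type*} [MeasurableSpace α] [MeasurableSpace β]

theorem eLp_top (μ : Measure α) (f : α → ℝ≥0∞) : eLp ∞ μ f = essSup f μ := if_pos rfl

theorem eLp_of_ne_top {p : ℝ≥0∞} (hp : p ≠ ∞) (μ : Measure α) (f : α → ℝ≥0∞) :
    eLp p μ f = (∫⁻ x, f x ^ p.toReal ∂μ) ^ (1 / p.toReal) := if_neg hp

theorem eLp_eq_eLpNorm {p : ℝ≥0∞} (hp : p ≠ 0) (μ : Measure α) (f : α → ℝ≥0∞) :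
    eLp p μ f = eLpNorm f p μ := by
  rcases eq_or_ne p ∞ with rfl | h
  · simp [eLp_top, eLpNormEssSup]
  · simp [eLp_of_ne_top h, eLpNorm_eq_lintegral_rpow_enorm_toReal hp h]

theorem eLp_mono_ae {p : ℝ≥0∞} {μ : Measure α} {f g : α → ℝ≥0∞} (h : f ≤ᵐ[μ] g) :
    eLp p μ f ≤ eLp p μ g := by
  rcases eq_or_ne p ∞ with rfl | hp
  · simpa only [eLp_top] using essSup_mono_ae h
  · rw [eLp_of_ne_top hp, eLp_of_ne_top hp]
    refine ENNReal.rpow_le_rpow (lintegral_mono_ae (h.mono fun x hx => ?_)) (by positivity)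
    exact ENNReal.rpow_le_rpow hx (by positivity)

theorem eLp_mono {p : ℝ≥0∞} {μ : Measure α} {f g : α → ℝ≥0∞} (h : ∀ x, f x ≤ g x) :
    eLp p μ f ≤ eLp p μ g := eLp_mono_ae (Filter.Eventually.of_forall h)

theorem eLp_const_mul {p : ℝ≥0∞} (hp : 1 ≤ p) (μ : Measure α) {c : ℝ≥0∞} (hc : c ≠ ∞)
    (f : α → ℝ≥0∞) : eLp p μ (fun x => c * f x) = c * eLp p μ f := by
  rcases eq_or_ne p ∞ with rfl | h
  · simpa only [eLp_top] using ENNReal.essSup_const_mul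
  · have h0 : 0 < p.toReal := ENNReal.toReal_pos (by positivity) h
    simp only [eLp_of_ne_top h, ENNReal.mul_rpow_of_nonneg _ _ h0.le]
    rw [lintegral_const_mul' _ _ (ENNReal.rpow_ne_top_of_nonneg h0.le hc),
      ENNReal.mul_rpow_of_nonneg _ _ (by positivity), ← ENNReal.rpow_mul,
      mul_one_div_cancel h0.ne', ENNReal.rpow_one]

theorem eLp_zero {p : ℝ≥0∞} (hp : 1 ≤ p) (μ : Measure α) : eLp p μ (fun _ => 0) = 0 := by
  rw [eLp_eq_eLpNorm (by positivity)]; exact eLpNorm_zero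

theorem measurable_eLp {p : ℝ≥0∞} {ν : Measure β} [SFinite ν] {f : α → β → ℝ≥0∞}
    (hf : Measurable fun w : α × β => f w.1 w.2) : Measurable fun a => eLp p ν (f a) := by
  rcases eq_or_ne p ∞ with rfl | hp
  · simp only [eLp_top]
    refine measurable_of_Iic fun c => ?_
    have : (fun a => essSup (f a) ν) ⁻¹' Iic c = {a | ν (Prod.mk a ⁻¹' {w | c < f w.1 w.2}) = 0} := by
      ext a
      have : essSup (f a) ν ≤ c ↔ ∀ᵐ b ∂ν, f a b ≤ c :=
        ⟨fun h => (ENNReal.ae_le_essSup _).mono fun b hb => hb.trans h,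
          fun h => essSup_le_of_ae_le _ h⟩
      simp only [mem_preimage, mem_Iic, this, ae_iff, not_le, mem_ofPred_eq, preimage_ofPred_eq]
    rw [this]
    exact measurable_measure_prodMk_left (measurableSet_lt measurable_const hf)
      (measurableSet_singleton 0)
  · simp only [eLp_of_ne_top hp]
    exact (Measurable.lintegral_prod_right' (hf.pow_const _)).pow_const _

theorem eLp_top_mul_le {p : ℝ≥0∞} (hp : 1 ≤ p) {μ : Measure α} {f g : α → ℝ≥0∞} (hgm : Measurable g) :
    eLp p μ (fun x => f x * g x) ≤ eLp ∞ μ f * eLp p μ g := by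
  rw [eLp_top]
  by_cases hc : essSup f μ = ∞
  · rw [hc]
    by_cases hg : eLp p μ g = 0
    · have h1 : ∀ᵐ x ∂μ, f x * g x ≤ 0 := by
        rw [eLp_eq_eLpNorm (by positivity),
          eLpNorm_eq_zero_iff hgm.aestronglyMeasurable (by positivity)] at hg
        filter_upwards [hg] with x hx
        simp [hx]
      exact (eLp_mono_ae h1).trans ((eLp_zero hp μ).le.trans bot_le)
    · rw [ENNReal.top_mul hg]; exact le_top
  · rw [← eLp_const_mul hp μ hc]
    refine eLp_mono_ae ((ENNReal.ae_le_essSup f).mono fun x hx => ?_)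
    dsimp only; gcongr

theorem eLp_mul_le {p p₁ p₂ : ℝ≥0∞} (hp : 1 ≤ p) (hp₁ : 1 ≤ p₁) (hp₂ : 1 ≤ p₂)
    (h : 1 / p = 1 / p₁ + 1 / p₂) {μ : Measure α} {f g : α → ℝ≥0∞} (hf : Measurable f)
    (hg : Measurable g) : eLp p μ (fun x => f x * g x) ≤ eLp p₁ μ f * eLp p₂ μ g := by
  rcases eq_or_ne p₁ ∞ with rfl | h₁
  · obtain rfl : p = p₂ := by simpa using h
    exact eLp_top_mul_le hp hg
  rcases eq_or_ne p₂ ∞ with rfl | h₂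
  · obtain rfl : p = p₁ := by simpa using h
    simpa only [mul_comm] using eLp_top_mul_le (f := g) (g := f) (μ := μ) hp hf
  have hpt : p ≠ ∞ := by
    rintro rfl
    exact h₁ (by simpa using (add_eq_zero.1 (h.symm.trans (by simp))).1)
  have e : 1 / p.toReal = 1 / p₁.toReal + 1 / p₂.toReal := by
    have := congrArg ENNReal.toReal h
    rwa [ENNReal.toReal_add (by simp; positivity) (by simp; positivity), ENNReal.toReal_div,
      ENNReal.toReal_div, ENNReal.toReal_div, ENNReal.toReal_one] at this
  have a0 : 0 < p.toReal := ENNReal.toReal_pos (by positivity) hpt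
  have a1 : 0 < p₁.toReal := ENNReal.toReal_pos (by positivity) h₁
  have a2 : 0 < p₂.toReal := ENNReal.toReal_pos (by positivity) h₂
  have lt : p.toReal < p₁.toReal := by
    rw [← one_div_lt_one_div a1 a0, e]
    exact lt_add_of_pos_right _ (by positivity)
  rw [eLp_of_ne_top hpt, eLp_of_ne_top h₁, eLp_of_ne_top h₂]
  exact ENNReal.lintegral_Lp_mul_le_Lq_mul_Lr a0 lt e μ hf.aemeasurable hg.aemeasurable

theorem eLp_rpow {s : ℝ≥0∞} {a : ℝ} (ha : 0 < a) (μ : Measure α) (f : α → ℝ≥0∞) :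
    eLp s μ (fun x => f x ^ a) = eLp (s * ENNReal.ofReal a) μ f ^ a := by
  rcases eq_or_ne s ∞ with rfl | hs
  · rw [ENNReal.top_mul (by simpa using ha), eLp_top, eLp_top]
    exact (OrderIso.essSup_apply f μ (ENNReal.orderIsoRpow a ha)).symm
  · rw [eLp_of_ne_top hs, eLp_of_ne_top (ENNReal.mul_ne_top hs ENNReal.ofReal_ne_top)]
    simp only [ENNReal.toReal_mul, ENNReal.toReal_ofReal ha.le, ← ENNReal.rpow_mul]
    congr 1
    · simp only [mul_comm]
    · field_simp

theorem eLp_le_of_exponent_le {p q : ℝ≥0∞} (hp : 1 ≤ p) (hpq : p ≤ q) {μ : Measure α}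
    [IsProbabilityMeasure μ] {f : α → ℝ≥0∞} (hf : Measurable f) : eLp p μ f ≤ eLp q μ f := by
  have hq := hp.trans hpq
  rcases eq_or_ne p ∞ with rfl | hp'
  · rw [top_le_iff.1 hpq]
  set r := (1 / p - 1 / q)⁻¹ with hr
  have h1r : 1 ≤ r := by
    rw [hr, ENNReal.one_le_inv]
    exact tsub_le_self.trans (by simpa using hp)
  have := eLp_mul_le hp hq h1r (μ := μ) (f := f) (g := fun _ => 1)
    (by rw [hr, one_div (_⁻¹), inv_inv, add_tsub_cancel_of_le (by simpa using hpq)])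
    hf measurable_const
  have h1 : eLp r μ (fun _ => 1) = 1 := by
    rcases eq_or_ne r ∞ with h | h
    · rw [h, eLp_top, essSup_const]; exact IsProbabilityMeasure.ne_zero μ
    · simp [eLp_of_ne_top h]
  simpa [h1] using this

theorem eLp_lintegral_le_of_ne_top {p : ℝ} (hp : 1 < p) {μ : Measure α} [SigmaFinite μ]
    {ν : Measure β} [SFinite ν] {f : α → β → ℝ≥0∞} (hf : Measurable fun w : α × β => f w.1 w.2) :
    (∫⁻ x, (∫⁻ z, f x z ∂ν) ^ p ∂μ) ^ (1 / p) ≤ ∫⁻ z, (∫⁻ x, f x z ^ p ∂μ) ^ (1 / p) ∂ν := by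
  have p0 : 0 < p := by linarith
  set F : α → ℝ≥0∞ := fun x => ∫⁻ z, f x z ∂ν with hFdef
  have hF : Measurable F := Measurable.lintegral_prod_right' hf
  set R := ∫⁻ z, (∫⁻ x, f x z ^ p ∂μ) ^ (1 / p) ∂ν with hR
  have key : ∀ h : α → ℝ≥0∞, Measurable h → (∀ x, h x ≤ F x) → ∫⁻ x, h x ^ p ∂μ ≠ ∞ →
      ∫⁻ x, h x ^ p ∂μ ≤ R ^ p := by
    intro h hm hle hfin
    set I := ∫⁻ x, h x ^ p ∂μ with hI
    rcases eq_or_ne I 0 with h0 | h0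
    · rw [h0]; exact bot_le
    have hpq : p.HolderConjugate (p / (p - 1)) := Real.HolderConjugate.conjExponent hp
    have step : I ≤ I ^ (1 / (p / (p - 1))) * R := by
      calc I ≤ ∫⁻ x, ∫⁻ z, h x ^ (p - 1) * f x z ∂ν ∂μ := by
            refine lintegral_mono fun x => ?_
            have hfx : Measurable (f x) := hf.comp measurable_prodMk_left
            rw [lintegral_const_mul _ hfx]
            calc h x ^ p = h x ^ ((p - 1) + 1) := by ring_nf
              _ = h x ^ (p - 1) * h x := by
                rw [ENNReal.rpow_add_of_nonneg _ _ (by linarith) zero_le_one, ENNReal.rpow_one]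
              _ ≤ _ := by gcongr; exact hle x
        _ = ∫⁻ z, ∫⁻ x, h x ^ (p - 1) * f x z ∂μ ∂ν := by
            refine lintegral_lintegral_swap (Measurable.aemeasurable ?_)
            exact ((hm.comp measurable_fst).pow_const _).mul hf
        _ ≤ ∫⁻ z, I ^ (1 / (p / (p - 1))) * (∫⁻ x, f x z ^ p ∂μ) ^ (1 / p) ∂ν := by
            refine lintegral_mono fun z => ?_
            refine (ENNReal.lintegral_mul_le_Lp_mul_Lq μ hpq.symm (hm.pow_const _).aemeasurable
              (hf.comp measurable_prodMk_right).aemeasurable).trans_eq ?_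
            simp only [← ENNReal.rpow_mul, mul_div_cancel₀ _ (show p - 1 ≠ 0 by linarith), hI]
            rfl
        _ = _ := by
            refine lintegral_const_mul _ (Measurable.pow_const ?_ _)
            exact Measurable.lintegral_prod_left' (hf.pow_const p)
    have hexp : 1 / (p / (p - 1)) = 1 - 1 / p := by field_simp
    rw [hexp] at step
    have hlt : I ^ (1 - 1 / p) ≠ ∞ := ENNReal.rpow_ne_top_of_nonneg
      (by rw [sub_nonneg, div_le_one p0]; exact hp.le) hfin
    have hne : I ^ (1 - 1 / p) ≠ 0 := by simp [h0, hfin]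
    have : I ^ (1 / p) ≤ R := by
      rw [← ENNReal.mul_le_mul_iff_right hne hlt, ← ENNReal.rpow_add _ _ h0 hfin]
      simpa using step
    calc I = (I ^ (1 / p)) ^ p := by
          rw [← ENNReal.rpow_mul, one_div_mul_cancel p0.ne', ENNReal.rpow_one]
      _ ≤ R ^ p := by gcongr
  set H : ℕ → α → ℝ≥0∞ := fun n => (spanningSets μ n).indicator fun x => min (F x) n with hH
  have Hm : ∀ n, Measurable (H n) := fun n =>
    (hF.min measurable_const).indicator (measurableSet_spanningSets μ n)
  have Hle : ∀ n x, H n x ≤ F x := fun n x => by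
    by_cases hx : x ∈ spanningSets μ n <;> simp [hH, hx]
  have Hmono : Monotone H := by
    intro m n hmn x
    by_cases hx : x ∈ spanningSets μ m
    · have hx' := monotone_spanningSets μ hmn hx
      simp only [hH, indicator_of_mem hx, indicator_of_mem hx']
      gcongr
    · simp [hH, hx]
  have Hsup : ∀ x, ⨆ n, H n x ^ p = F x ^ p := by
    intro x
    refine le_antisymm (iSup_le fun n => by gcongr; exact Hle n x) ?_
    have h1 : Filter.Tendsto (fun n => H n x ^ p) Filter.atTop (nhds (F x ^ p)) := by
      refine (ENNReal.continuous_rpow_const.tendsto _).comp ?_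
      have h2 : Filter.Tendsto (fun n : ℕ => min (F x) (n : ℝ≥0∞)) Filter.atTop
          (nhds (min (F x) ∞)) := tendsto_const_nhds.min ENNReal.tendsto_nat_nhds_top
      rw [min_eq_left le_top] at h2
      refine h2.congr' ?_
      filter_upwards [Filter.eventually_ge_atTop (spanningSetsIndex μ x)] with n hn
      have := monotone_spanningSets μ hn (mem_spanningSetsIndex μ x)
      simp [hH, this]
    exact le_of_tendsto' h1 fun n => le_iSup (fun n => H n x ^ p) n
  have hfinal : ∫⁻ x, F x ^ p ∂μ ≤ R ^ p := by
    simp only [← Hsup]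
    rw [lintegral_iSup (fun n => (Hm n).pow_const p) fun m n hmn x => by
      dsimp only; gcongr; exact Hmono hmn x]
    refine iSup_le fun n => key _ (Hm n) (Hle n) (ne_of_lt ?_)
    calc ∫⁻ x, H n x ^ p ∂μ ≤ ∫⁻ x, (spanningSets μ n).indicator (fun _ => (n : ℝ≥0∞) ^ p) x ∂μ := by
          refine lintegral_mono fun x => ?_
          by_cases hx : x ∈ spanningSets μ n
          · simp only [hH, indicator_of_mem hx]; gcongr; exact min_le_right _ _
          · simp [hH, hx, p0]
      _ = (n : ℝ≥0∞) ^ p * μ (spanningSets μ n) := by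
          rw [lintegral_indicator_const (measurableSet_spanningSets μ n)]
      _ < ∞ := ENNReal.mul_lt_top (ENNReal.rpow_lt_top_of_nonneg p0.le (by simp))
          (measure_spanningSets_lt_top μ n)
  calc _ ≤ (R ^ p) ^ (1 / p) := by gcongr
    _ = R := by rw [← ENNReal.rpow_mul, mul_one_div_cancel p0.ne', ENNReal.rpow_one]

/-- Minkowski's integral inequality. -/
theorem eLp_lintegral_le {p : ℝ≥0∞} (hp : 1 ≤ p) {μ : Measure α} [SigmaFinite μ]
    {ν : Measure β} [SFinite ν] {f : α → β → ℝ≥0∞} (hf : Measurable fun w : α × β => f w.1 w.2) :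
    eLp p μ (fun x => ∫⁻ z, f x z ∂ν) ≤ ∫⁻ z, eLp p μ (fun x => f x z) ∂ν := by
  rcases eq_or_ne p ∞ with rfl | hpt
  · have hm : Measurable fun z => eLp ∞ μ fun x => f x z :=
      measurable_eLp (f := fun z x => f x z) (hf.comp measurable_swap)
    rw [eLp_top]
    refine essSup_le_of_ae_le _ ?_
    have h1 : ∀ᵐ z ∂ν, ∀ᵐ x ∂μ, f x z ≤ eLp ∞ μ (fun x => f x z) :=
      Filter.Eventually.of_forall fun z => by
        rw [eLp_top]; exact ENNReal.ae_le_essSup _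
    have h2 : ∀ᵐ x ∂μ, ∀ᵐ z ∂ν, f x z ≤ eLp ∞ μ (fun x => f x z) :=
      (Measure.ae_ae_comm (p := fun z x => f x z ≤ eLp ∞ μ (fun x => f x z))
        (measurableSet_le (hf.comp measurable_swap) (hm.comp measurable_fst))).1 h1
    filter_upwards [h2] with x hx using lintegral_mono_ae hx
  simp only [eLp_of_ne_top hpt]
  rcases eq_or_lt_of_le hp with rfl | h1
  · simp only [ENNReal.toReal_one, ENNReal.rpow_one, div_one]
    exact (lintegral_lintegral_swap hf.aemeasurable).le
  · refine eLp_lintegral_le_of_ne_top ?_ hf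
    rwa [← ENNReal.toReal_one, ENNReal.toReal_lt_toReal ENNReal.one_ne_top hpt]

/-- Minkowski's inequality for mixed norms. -/
theorem eLp_eLp_le_swap {p s : ℝ≥0∞} (hp : 1 ≤ p) (hpt : p ≠ ∞) (hps : p ≤ s) {μ : Measure α}
    [SigmaFinite μ] {ν : Measure β} [SFinite ν] {f : α → β → ℝ≥0∞}
    (hf : Measurable fun w : α × β => f w.1 w.2) :
    eLp s μ (fun x => eLp p ν (f x)) ≤ eLp p ν (fun z => eLp s μ fun x => f x z) := by
  have p0 : 0 < p.toReal := ENNReal.toReal_pos (by positivity) hpt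
  have hr : s * ENNReal.ofReal (1 / p.toReal) * ENNReal.ofReal p.toReal = s := by
    rw [mul_assoc, ← ENNReal.ofReal_mul (by positivity), one_div_mul_cancel p0.ne',
      ENNReal.ofReal_one, mul_one]
  simp only [eLp_of_ne_top hpt]
  rw [eLp_rpow (by positivity)]
  refine ENNReal.rpow_le_rpow ((eLp_lintegral_le ?_ (hf.pow_const _)).trans_eq ?_) (by positivity)
  · have : p * ENNReal.ofReal (1 / p.toReal) ≤ s * ENNReal.ofReal (1 / p.toReal) := by gcongr
    refine le_trans (le_of_eq ?_) this
    rw [one_div, ENNReal.ofReal_inv_of_pos p0, ENNReal.ofReal_toReal hpt,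
      ENNReal.mul_inv_cancel (by positivity) hpt]
  · simp only [eLp_rpow p0, hr]

theorem eLp_sub_right {E : Type*} [AddGroup E] [MeasurableSpace E] [MeasurableAdd E]
    (p : ℝ≥0∞) (μ : Measure E) [μ.IsAddRightInvariant] (f : E → ℝ≥0∞) (c : E) :
    eLp p μ (fun x => f (x - c)) = eLp p μ f := by
  rcases eq_or_ne p ∞ with rfl | hp
  · rw [eLp_top, eLp_top]
    have := (measurableEmbedding_subRight c).essSup_map_measure (g := f) (μ := μ)
    rw [(measurePreserving_sub_right μ c).map_eq] at this
    exact this.symm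
  · rw [eLp_of_ne_top hp, eLp_of_ne_top hp, lintegral_sub_right_eq_self (fun x => f x ^ p.toReal)]

theorem eLp_restrict {p : ℝ≥0∞} (hp : 1 ≤ p) (μ : Measure α) {A : Set α} (hA : MeasurableSet A)
    (f : α → ℝ≥0∞) : eLp p (μ.restrict A) f = eLp p μ (A.indicator f) := by
  rcases eq_or_ne p ∞ with rfl | hpt
  · rw [eLp_top, eLp_top, ENNReal.essSup_indicator_eq_essSup_restrict hA]
  · have p0 : 0 < p.toReal := ENNReal.toReal_pos (by positivity) hpt
    rw [eLp_of_ne_top hpt, eLp_of_ne_top hpt, ← lintegral_indicator hA]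
    congr 2
    ext x
    by_cases hx : x ∈ A <;> simp [hx, p0]

end LpToolkit

section Unfolding

variable {E : Type*} [NormedAddCommGroup E] [MeasurableSpace E] [BorelSpace E]

open scoped Pointwise in
theorem setLIntegral_add_left_of_periodic {μ : Measure E} [μ.IsAddLeftInvariant]
    {L : AddSubgroup E} [Countable L] {D : Set E} (hD : IsAddFundamentalDomain L D μ)
    {h : E → ℝ≥0∞} (hh : ∀ l ∈ L, ∀ y, h (l + y) = h y) (c : E) :
    ∫⁻ u in D, h (c + u) ∂μ = ∫⁻ u in D, h u ∂μ := by
  have h1 : IsAddFundamentalDomain L (c +ᵥ D) μ := hD.vadd_of_comm c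
  rw [hD.setLIntegral_eq h1 h fun g x => hh g g.2 x,
    ← (measurePreserving_add_left μ c).setLIntegral_comp_preimage_emb
      (measurableEmbedding_addLeft c) h (c +ᵥ D)]
  congr 2
  ext x
  simp [mem_vadd_set_iff_neg_vadd_mem]

variable [SecondCountableTopology E] [NormedSpace ℝ E]

/-- Unfolding of a function of a slow and a periodic fast variable. -/
theorem lintegral_le_lintegral_setLIntegral_of_periodic {μ : Measure E} [SFinite μ]
    [μ.IsAddLeftInvariant] {L : AddSubgroup E} [Countable L] {D : Set E}
    (hD : IsAddFundamentalDomain L D μ) (hD1 : μ D = 1) {c : ℝ} (hc : c ≠ 0)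
    {H : E → ℝ≥0∞} {K : E → E → ℝ≥0∞} (hK : Measurable fun w : E × E => K w.1 w.2)
    (hper : ∀ x, ∀ l ∈ L, ∀ y, K x (l + y) = K x y)
    (hHK : ∀ x, ∀ u ∈ D, H x ≤ K (x - c • u) (c⁻¹ • x)) :
    ∫⁻ x, H x ∂μ ≤ ∫⁻ x, ∫⁻ y in D, K x y ∂μ ∂μ := by
  calc ∫⁻ x, H x ∂μ ≤ ∫⁻ x, ∫⁻ u in D, K (x - c • u) (c⁻¹ • x) ∂μ ∂μ := by
        refine lintegral_mono fun x => ?_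
        calc H x = ∫⁻ u in D, H x ∂μ := by simp [hD1]
          _ ≤ _ := lintegral_mono_ae
            ((ae_restrict_mem₀ hD.nullMeasurableSet).mono fun u hu => hHK x u hu)
    _ = ∫⁻ u in D, ∫⁻ x, K (x - c • u) (c⁻¹ • x) ∂μ ∂μ := by
        refine lintegral_lintegral_swap (Measurable.aemeasurable ?_)
        exact hK.comp (f := fun w : E × E => (w.1 - c • w.2, c⁻¹ • w.1)) (by fun_prop)
    _ = ∫⁻ u in D, ∫⁻ x, K x (c⁻¹ • x + u) ∂μ ∂μ := by
        refine lintegral_congr fun u => ?_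
        rw [← lintegral_sub_right_eq_self (fun x => K x (c⁻¹ • x + u)) (c • u)]
        simp [smul_sub, smul_smul, hc]
    _ = ∫⁻ x, ∫⁻ u in D, K x (c⁻¹ • x + u) ∂μ ∂μ := by
        refine lintegral_lintegral_swap (Measurable.aemeasurable ?_)
        exact hK.comp (f := fun w : E × E => (w.2, c⁻¹ • w.2 + w.1)) (by fun_prop)
    _ = ∫⁻ x, ∫⁻ y in D, K x y ∂μ ∂μ :=
        lintegral_congr fun x => setLIntegral_add_left_of_periodic hD (hper x) _

/-- Unfolding estimate for `eLp`. -/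
theorem eLp_le_eLp_eLp_of_periodic {μ : Measure E} [SFinite μ]
    [μ.IsAddLeftInvariant] {L : AddSubgroup E} [Countable L] {D : Set E}
    (hD : IsAddFundamentalDomain L D μ) (hD1 : μ D = 1) {c : ℝ} (hc : c ≠ 0)
    {p : ℝ≥0∞} (hp : 1 ≤ p) (hpt : p ≠ ∞)
    {H : E → ℝ≥0∞} {K : E → E → ℝ≥0∞} (hK : Measurable fun w : E × E => K w.1 w.2)
    (hper : ∀ x, ∀ l ∈ L, ∀ y, K x (l + y) = K x y)
    (hHK : ∀ x, ∀ u ∈ D, H x ≤ K (x - c • u) (c⁻¹ • x)) :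
    eLp p μ H ≤ eLp p μ fun x => eLp p (μ.restrict D) (K x) := by
  have p0 : 0 < p.toReal := ENNReal.toReal_pos (by positivity) hpt
  simp only [eLp_of_ne_top hpt, ← ENNReal.rpow_mul, one_div_mul_cancel p0.ne', ENNReal.rpow_one]
  refine ENNReal.rpow_le_rpow ?_ (by positivity)
  refine lintegral_le_lintegral_setLIntegral_of_periodic hD hD1 hc (hK.pow_const _) ?_ ?_
  · intro x l hl y; rw [hper x l hl y]
  · intro x u hu; exact ENNReal.rpow_le_rpow (hHK x u hu) p0.le

theorem isAddFundamentalDomain_Ioc_zero_one :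
    IsAddFundamentalDomain (AddSubgroup.zmultiples (1 : ℝ)) (Ioc (0 : ℝ) 1) := by
  simpa using isAddFundamentalDomain_Ioc one_pos 0

/-- The lattice `ℤ^d`. -/
def intLattice (d : ℕ) : AddSubgroup (Esp d) :=
  (Submodule.span ℤ (range (EuclideanSpace.basisFun (Fin d) ℝ).toBasis)).toAddSubgroup

instance (d : ℕ) : Countable (intLattice d) :=
  inferInstanceAs (Countable
    (Submodule.span ℤ (range (EuclideanSpace.basisFun (Fin d) ℝ).toBasis)))

theorem add_eq_of_mem_intLattice {d : ℕ} {X : Type*} {h : Esp d → X}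
    (hh : ∀ y i, h (y + EuclideanSpace.single i 1) = h y) {l : Esp d} (hl : l ∈ intLattice d) :
    ∀ y, h (l + y) = h y := by
  have hl' : l ∈ Submodule.span ℤ (range (EuclideanSpace.basisFun (Fin d) ℝ).toBasis) := hl
  clear hl
  rw [← Submodule.mem_toAddSubgroup, Submodule.span_int_eq_addSubgroupClosure] at hl'
  induction hl' using AddSubgroup.closure_induction with
  | mem x hx =>
    obtain ⟨i, rfl⟩ := hx
    intro y
    rw [add_comm]
    simpa using hh y i
  | zero => simp
  | add a b _ _ ha hb =>
    intro y
    rw [add_assoc, ha, hb]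
  | neg a _ ha => intro y; rw [← ha (-a + y)]; simp

theorem unitCell_eq_preimage (d : ℕ) :
    unitCell d = @WithLp.ofLp 2 (Fin d → ℝ) ⁻¹' Icc (fun _ => 0) (fun _ => 1) := by
  ext y; simp [unitCell, Pi.le_def, forall_and]

theorem unitCell_ae_eq (d : ℕ) :
    (unitCell d : Set (Esp d)) =ᵐ[volume]
      ZSpan.fundamentalDomain (EuclideanSpace.basisFun (Fin d) ℝ).toBasis := by
  have h := (PiLp.volume_preserving_ofLp (Fin d)).quasiMeasurePreserving.preimage_ae_eq
    (Measure.univ_pi_Ico_ae_eq_Icc (μ := fun _ : Fin d => (volume : Measure ℝ)) (f := fun _ => 0)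
      (g := fun _ => 1))
  have e : ZSpan.fundamentalDomain (EuclideanSpace.basisFun (Fin d) ℝ).toBasis =
      @WithLp.ofLp 2 (Fin d → ℝ) ⁻¹' univ.pi fun _ => Ico 0 1 := by
    ext y; simp [ZSpan.mem_fundamentalDomain]
  rw [e, unitCell_eq_preimage]
  exact h.symm

theorem volume_unitCell (d : ℕ) : volume (unitCell d) = 1 := by
  have h := (PiLp.volume_preserving_ofLp (Fin d)).measure_preimage
    (s := Icc (fun _ => 0) (fun _ => 1)) measurableSet_Icc.nullMeasurableSet
  rw [Real.volume_Icc_pi] at h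
  rw [unitCell_eq_preimage, h]; simp

end Unfolding

section MixedNorms

variable {d : ℕ}

/-- Joint measurability of an extended-nonnegative function of `(x, t, y, τ)`. -/
def MeasENN4 (a : Esp d → ℝ → Esp d → ℝ → ℝ≥0∞) : Prop :=
  Measurable fun w : (Esp d × ℝ) × Esp d × ℝ => a w.1.1 w.1.2 w.2.1 w.2.2

/-- The norm of `L^{q,p}(ℝ^{d+1}; L^{s,r})`. -/
def mixNorm4 (q p s r : ℝ≥0∞) (a : Esp d → ℝ → Esp d → ℝ → ℝ≥0∞) : ℝ≥0∞ :=
  eLp q volume fun t => eLp p volume fun x => eLp s (volume.restrict (Ioc (0 : ℝ) 1)) fun τ =>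
    eLp r (volume.restrict (unitCell d)) fun y => a x t y τ

/-- Moving average at spatial scale `ε` and temporal scale `ε ^ 2` with respect to `ρ`. -/
def slidingMean (ρ : Measure (Esp d × ℝ)) (ε : ℝ) (a : Esp d → ℝ → Esp d → ℝ → ℝ≥0∞) :
    Esp d → ℝ → Esp d → ℝ → ℝ≥0∞ :=
  fun x t y τ => ∫⁻ w, a (x - ε • w.1) (t - ε ^ 2 * w.2) y τ ∂ρ

theorem MeasENN4.comp {a : Esp d → ℝ → Esp d → ℝ → ℝ≥0∞} (ha : MeasENN4 a) {X : Type*}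
    [MeasurableSpace X] {x : X → Esp d} {t : X → ℝ} {y : X → Esp d} {τ : X → ℝ}
    (hx : Measurable x) (ht : Measurable t) (hy : Measurable y) (hτ : Measurable τ) :
    Measurable fun w => a (x w) (t w) (y w) (τ w) :=
  Measurable.comp ha ((hx.prodMk ht).prodMk (hy.prodMk hτ))

theorem MeasENN4.slidingMean {a : Esp d → ℝ → Esp d → ℝ → ℝ≥0∞} (ha : MeasENN4 a)
    (ρ : Measure (Esp d × ℝ)) [SFinite ρ] (ε : ℝ) : MeasENN4 (slidingMean ρ ε a) := by
  refine Measurable.lintegral_prod_right' (f := fun v : ((Esp d × ℝ) × Esp d × ℝ) × Esp d × ℝ =>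
    a (v.1.1.1 - ε • v.2.1) (v.1.1.2 - ε ^ 2 * v.2.2) v.1.2.1 v.1.2.2) ?_
  apply ha.comp <;> fun_prop

theorem MeasENN4.mul {a b : Esp d → ℝ → Esp d → ℝ → ℝ≥0∞} (ha : MeasENN4 a) (hb : MeasENN4 b) :
    MeasENN4 fun x t y τ => a x t y τ * b x t y τ :=
  Measurable.mul ha hb

theorem mixNorm4_slidingMean_le {q p s r : ℝ≥0∞} (hq : 1 ≤ q) (hp : 1 ≤ p) (hs : 1 ≤ s)
    (hr : 1 ≤ r) (ρ : Measure (Esp d × ℝ)) [SFinite ρ] (ε : ℝ)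
    {a : Esp d → ℝ → Esp d → ℝ → ℝ≥0∞} (ha : MeasENN4 a) :
    mixNorm4 q p s r (slidingMean ρ ε a) ≤ ρ univ * mixNorm4 q p s r a := by
  set b : Esp d × ℝ → Esp d → ℝ → Esp d → ℝ → ℝ≥0∞ :=
    fun w x t y τ => a (x - ε • w.1) (t - ε ^ 2 * w.2) y τ with hb
  set κ := volume.restrict (unitCell d)
  set ι := volume.restrict (Ioc (0 : ℝ) 1)
  have m1 : Measurable fun v : (Esp d × ℝ × ℝ × (Esp d × ℝ)) × Esp d =>
      b v.1.2.2.2 v.1.1 v.1.2.1 v.2 v.1.2.2.1 := by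
    apply ha.comp <;> fun_prop
  have m2 : Measurable fun v : Esp d × ℝ × ℝ × (Esp d × ℝ) =>
      eLp r κ fun y => b v.2.2.2 v.1 v.2.1 y v.2.2.1 := measurable_eLp m1
  have m3 : Measurable fun v : Esp d × ℝ × (Esp d × ℝ) =>
      eLp s ι fun τ => eLp r κ fun y => b v.2.2 v.1 v.2.1 y τ :=
    measurable_eLp (m2.comp (f := fun v : (Esp d × ℝ × (Esp d × ℝ)) × ℝ =>
      (v.1.1, v.1.2.1, v.2, v.1.2.2)) (by fun_prop))
  have m4 : Measurable fun v : ℝ × (Esp d × ℝ) =>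
      eLp p volume fun x => eLp s ι fun τ => eLp r κ fun y => b v.2 x v.1 y τ :=
    measurable_eLp (m3.comp (f := fun v : (ℝ × (Esp d × ℝ)) × Esp d =>
      (v.2, v.1.1, v.1.2)) (by fun_prop))
  have e1 : ∀ x t τ, eLp r κ (fun y => slidingMean ρ ε a x t y τ) ≤
      ∫⁻ w, eLp r κ (fun y => b w x t y τ) ∂ρ := fun x t τ =>
    eLp_lintegral_le hr (m1.comp (f := fun v : Esp d × (Esp d × ℝ) => ((x, t, τ, v.2), v.1))
      (by fun_prop))
  have e2 : ∀ x t, eLp s ι (fun τ => eLp r κ fun y => slidingMean ρ ε a x t y τ) ≤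
      ∫⁻ w, eLp s ι (fun τ => eLp r κ fun y => b w x t y τ) ∂ρ := fun x t =>
    (eLp_mono fun τ => e1 x t τ).trans <|
      eLp_lintegral_le hs (m2.comp (f := fun v : ℝ × (Esp d × ℝ) => (x, t, v.1, v.2))
        (by fun_prop))
  have e3 : ∀ t, eLp p volume (fun x => eLp s ι fun τ => eLp r κ fun y =>
      slidingMean ρ ε a x t y τ) ≤
      ∫⁻ w, eLp p volume (fun x => eLp s ι fun τ => eLp r κ fun y => b w x t y τ) ∂ρ := fun t =>
    (eLp_mono fun x => e2 x t).trans <|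
      eLp_lintegral_le hp (m3.comp (f := fun v : Esp d × (Esp d × ℝ) => (v.1, t, v.2))
        (by fun_prop))
  calc mixNorm4 q p s r (slidingMean ρ ε a) ≤ ∫⁻ w, mixNorm4 q p s r (b w) ∂ρ :=
        (eLp_mono e3).trans (eLp_lintegral_le hq m4)
    _ = ∫⁻ w, mixNorm4 q p s r a ∂ρ := by
        refine lintegral_congr fun w => ?_
        have h1 : ∀ t, eLp p volume (fun x => eLp s ι fun τ => eLp r κ fun y => b w x t y τ) =
            eLp p volume (fun x => eLp s ι fun τ => eLp r κ fun y =>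
              a x (t - ε ^ 2 * w.2) y τ) := fun t =>
          eLp_sub_right p volume (fun x => eLp s ι fun τ => eLp r κ fun y =>
              a x (t - ε ^ 2 * w.2) y τ) (ε • w.1)
        unfold mixNorm4
        simp only [κ, ι] at h1
        simp only [h1]
        exact eLp_sub_right q volume (fun t => eLp p volume fun x => eLp s ι fun τ =>
          eLp r κ fun y => a x t y τ) (ε ^ 2 * w.2)
    _ = ρ univ * mixNorm4 q p s r a := by rw [lintegral_const, mul_comm]

theorem eLp_mul_le_mixNorm4_mul {p q p₁ p₂ q₁ q₂ r₁ r₂ s₁ s₂ s : ℝ≥0∞}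
    (hp : 1 ≤ p) (hpt : p ≠ ∞) (hq : 1 ≤ q)
    (hp₁ : 1 ≤ p₁) (hp₂ : 1 ≤ p₂) (hq₁ : 1 ≤ q₁) (hq₂ : 1 ≤ q₂)
    (hr₁ : 1 ≤ r₁) (hr₂ : 1 ≤ r₂) (hs₁ : 1 ≤ s₁) (hs₂ : 1 ≤ s₂)
    (hp' : 1 / p = 1 / p₁ + 1 / p₂) (hr' : 1 / p = 1 / r₁ + 1 / r₂)
    (hq' : 1 / q = 1 / q₁ + 1 / q₂) (hs' : 1 / s = 1 / s₁ + 1 / s₂)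
    (hps : p ≤ s) (hqs : q ≤ s) {a b : Esp d → ℝ → Esp d → ℝ → ℝ≥0∞}
    (ha : MeasENN4 a) (hb : MeasENN4 b) :
    (eLp q volume fun t => eLp q (volume.restrict (Ioc (0 : ℝ) 1)) fun τ => eLp p volume fun x =>
      eLp p (volume.restrict (unitCell d)) fun y => a x t y τ * b x t y τ) ≤
      mixNorm4 q₁ p₁ s₁ r₁ a * mixNorm4 q₂ p₂ s₂ r₂ b := by
  set κ := volume.restrict (unitCell d)
  set ι := volume.restrict (Ioc (0 : ℝ) 1)
  have : IsProbabilityMeasure ι := ⟨by simp [ι]⟩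
  have m1 : ∀ {c : Esp d → ℝ → Esp d → ℝ → ℝ≥0∞} (r : ℝ≥0∞), MeasENN4 c →
      Measurable fun v : Esp d × ℝ × ℝ => eLp r κ fun y => c v.1 v.2.1 y v.2.2 := by
    intro c r hc
    refine measurable_eLp ?_
    apply hc.comp <;> fun_prop
  have m2 : ∀ {c : Esp d → ℝ → Esp d → ℝ → ℝ≥0∞} (s r : ℝ≥0∞), MeasENN4 c →
      Measurable fun v : Esp d × ℝ => eLp s ι fun τ => eLp r κ fun y => c v.1 v.2 y τ :=
    fun s r hc => measurable_eLp ((m1 r hc).comp (f := fun v : (Esp d × ℝ) × ℝ =>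
      (v.1.1, v.1.2, v.2)) (by fun_prop))
  have m3 : ∀ {c : Esp d → ℝ → Esp d → ℝ → ℝ≥0∞} (p s r : ℝ≥0∞), MeasENN4 c →
      Measurable fun t => eLp p volume fun x => eLp s ι fun τ => eLp r κ fun y => c x t y τ :=
    fun p s r hc => measurable_eLp ((m2 s r hc).comp (f := fun v : ℝ × Esp d => (v.2, v.1))
      (by fun_prop))
  have key : ∀ t, eLp q ι (fun τ => eLp p volume fun x => eLp p κ fun y =>
      a x t y τ * b x t y τ) ≤
      (eLp p₁ volume fun x => eLp s₁ ι fun τ => eLp r₁ κ fun y => a x t y τ) *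
      (eLp p₂ volume fun x => eLp s₂ ι fun τ => eLp r₂ κ fun y => b x t y τ) := by
    intro t
    have m4 := (m1 p (ha.mul hb)).comp (f := fun v : ℝ × Esp d => (v.2, t, v.1)) (by fun_prop)
    calc _ ≤ eLp s ι (fun τ => eLp p volume fun x => eLp p κ fun y => a x t y τ * b x t y τ) :=
          eLp_le_of_exponent_le hq hqs (measurable_eLp m4)
      _ ≤ eLp p volume (fun x => eLp s ι fun τ => eLp p κ fun y => a x t y τ * b x t y τ) :=
          eLp_eLp_le_swap hp hpt hps m4
      _ ≤ eLp p volume (fun x => (eLp s₁ ι fun τ => eLp r₁ κ fun y => a x t y τ) *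
            (eLp s₂ ι fun τ => eLp r₂ κ fun y => b x t y τ)) := by
          refine eLp_mono fun x => ?_
          refine (eLp_mono fun τ => ?_).trans (eLp_mul_le (hp.trans hps) hs₁ hs₂ hs'
            ((m1 r₁ ha).comp (f := fun τ => (x, t, τ)) (by fun_prop))
            ((m1 r₂ hb).comp (f := fun τ => (x, t, τ)) (by fun_prop)))
          refine eLp_mul_le hp hr₁ hr₂ hr' ?_ ?_
          · apply ha.comp <;> fun_prop
          · apply hb.comp <;> fun_prop
      _ ≤ _ := eLp_mul_le hp hp₁ hp₂ hp'
          ((m2 s₁ r₁ ha).comp (f := fun x => (x, t)) (by fun_prop))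
          ((m2 s₂ r₂ hb).comp (f := fun x => (x, t)) (by fun_prop))
  exact (eLp_mono key).trans (eLp_mul_le hq hq₁ hq₂ hq' (m3 p₁ s₁ r₁ ha) (m3 p₂ s₂ r₂ hb))

/-- Unfolding of an oscillating function of space and time. -/
theorem eLp_eLp_le_of_periodic {p q : ℝ≥0∞} (hp : 1 ≤ p) (hpt : p ≠ ∞) (hq : 1 ≤ q) (hqt : q ≠ ∞)
    {ε : ℝ} (hε : 0 < ε) {V : Esp d → ℝ → Esp d → ℝ → ℝ≥0∞} (hV : MeasENN4 V)
    (hVy : ∀ x t y τ i, V x t (y + EuclideanSpace.single i 1) τ = V x t y τ)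
    (hVτ : ∀ x t y τ, V x t y (τ + 1) = V x t y τ) {U : Esp d → ℝ → ℝ≥0∞}
    (hUV : ∀ x t, ∀ u ∈ unitCell d, ∀ v ∈ Ioc (0 : ℝ) 1,
      U x t ≤ V (x - ε • u) (t - ε ^ 2 * v) (ε⁻¹ • x) (t / ε ^ 2)) :
    (eLp q volume fun t => eLp p volume fun x => U x t) ≤
      eLp q volume fun t => eLp q (volume.restrict (Ioc (0 : ℝ) 1)) fun τ =>
        eLp p volume fun x => eLp p (volume.restrict (unitCell d)) fun y => V x t y τ := by
  set κ := volume.restrict (unitCell d) with hκ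
  have m1 : Measurable fun w : (ℝ × ℝ) × Esp d => eLp p κ fun y => V w.2 w.1.1 y w.1.2 := by
    refine measurable_eLp ?_
    apply hV.comp <;> fun_prop
  have m2 : Measurable fun w : ℝ × ℝ => eLp p volume fun x => eLp p κ fun y => V x w.1 y w.2 :=
    measurable_eLp m1
  refine eLp_le_eLp_eLp_of_periodic isAddFundamentalDomain_Ioc_zero_one (by simp)
    (pow_pos hε 2).ne' hq hqt m2 ?_ ?_
  · intro t l hl τ
    have : ∀ x y τ, V x t y (l + τ) = V x t y τ := by
      intro x y
      obtain ⟨n, rfl⟩ := AddSubgroup.mem_zmultiples_iff.1 hl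
      have hP : Function.Periodic (V x t y) 1 := hVτ x t y
      intro τ
      rw [add_comm]
      exact hP.zsmul n τ
    simp only [this]
  · intro t v hv
    have hae := unitCell_ae_eq d
    rw [hκ, Measure.restrict_congr_set hae]
    refine eLp_le_eLp_eLp_of_periodic (L := intLattice d)
      (ZSpan.isAddFundamentalDomain _ _) ?_ hε.ne' hp hpt
      (K := fun x y => V x (t - ε ^ 2 • v) y ((ε ^ 2)⁻¹ • t)) ?_ ?_ ?_
    · rw [← measure_congr hae, volume_unitCell]
    · apply hV.comp <;> fun_prop
    · intro x l hl
      exact add_eq_of_mem_intLattice (h := fun y => V x (t - ε ^ 2 • v) y ((ε ^ 2)⁻¹ • t))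
        (fun y i => hVy _ _ _ _ i) hl
    · intro x u hu
      have hu' : u ∈ unitCell d := fun i => by
        have := hu i
        exact Ico_subset_Icc_self (by simpa using this)
      simpa [div_eq_inv_mul] using hUV x t u hu' v hv

end MixedNorms

section Smoothing

variable {d : ℕ}

theorem S4_eq_integral (φ₁ : ℝ → ℝ) (φ₂ : Esp d → ℝ) {ε : ℝ} (hε : 0 < ε)
    (g : Esp d → ℝ → Esp d → ℝ → ℝ) (x : Esp d) (t : ℝ) (y : Esp d) (τ : ℝ) :
    S4 φ₁ φ₂ ε g x t y τ =
      ∫ s : ℝ, (∫ z : Esp d, g (x - ε • z) (t - ε ^ 2 * s) y τ * φ₂ z) * φ₁ s := by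
  have hx : ∀ t, Sx4 φ₂ ε g x t y τ = ∫ z : Esp d, g (x - ε • z) t y τ * φ₂ z := by
    intro t
    have := Measure.integral_comp_inv_smul_of_nonneg (volume : Measure (Esp d))
      (fun z => g (x - ε • z) t y τ * φ₂ z) hε.le
    simp only [smul_smul, mul_inv_cancel₀ hε.ne', one_smul, finrank_euclideanSpace_fin] at this
    rw [← inv_smul_eq_iff₀ (pow_pos hε d).ne', ← integral_smul] at this
    rw [← this, Sx4]
    congr 1 with z
    simp only [smul_eq_mul]; ring
  have h2 : 0 < ε ^ 2 := pow_pos hε 2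
  have := Measure.integral_comp_inv_smul_of_nonneg (volume : Measure ℝ)
    (fun s => (∫ z : Esp d, g (x - ε • z) (t - ε ^ 2 * s) y τ * φ₂ z) * φ₁ s) h2.le
  rw [Module.finrank_self, pow_one, ← inv_smul_eq_iff₀ h2.ne', ← integral_smul] at this
  rw [← this, S4, St4]
  congr 1 with s
  rw [hx]
  simp only [smul_eq_mul, mul_inv_cancel_left₀ h2.ne', div_eq_inv_mul]
  ring

/-- Zero extension of `|g|` outside the space-time region `A`. -/
def zeroExt (A : Set (Esp d × ℝ)) (g : Esp d → ℝ → Esp d → ℝ → ℝ) :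
    Esp d → ℝ → Esp d → ℝ → ℝ≥0∞ :=
  fun x t y τ => A.indicator (fun _ => ‖g x t y τ‖ₑ) (x, t)

theorem MeasENN4.zeroExt {A : Set (Esp d × ℝ)} (hA : MeasurableSet A)
    {g : Esp d → ℝ → Esp d → ℝ → ℝ} (hg : Meas4 g) : MeasENN4 (zeroExt A g) := by
  have : (fun w : (Esp d × ℝ) × Esp d × ℝ => _root_.zeroExt A g w.1.1 w.1.2 w.2.1 w.2.2) =
      (Prod.fst ⁻¹' A).indicator fun w => ‖g w.1.1 w.1.2 w.2.1 w.2.2‖ₑ := by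
    ext w
    by_cases hw : w.1 ∈ A <;> simp [_root_.zeroExt, hw]
  rw [MeasENN4, this]
  exact hg.enorm.indicator (measurable_fst hA)

theorem mixNorm4_zeroExt {A : Set (Esp d × ℝ)} (hA : MeasurableSet A) {q p s r : ℝ≥0∞}
    (hp : 1 ≤ p) (hs : 1 ≤ s) (hr : 1 ≤ r) (g : Esp d → ℝ → Esp d → ℝ → ℝ) :
    mixNorm4 q p s r (zeroExt A g) = mixNorm q p A fun x t => cellNorm s r (g x t) := by
  unfold mixNorm4 mixNorm
  congr 1 with t
  refine Eq.trans ?_ (eLp_restrict hp volume (A := {x | (x, t) ∈ A})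
    (measurable_prodMk_right hA) _).symm
  congr 1 with x
  by_cases hx : (x, t) ∈ A
  · simp [zeroExt, cellNorm, hx, enorm_eq_nnnorm]
  · simp [zeroExt, hx, eLp_zero hs, eLp_zero hr]

/-- The averaging measure dominating the smoothing kernels. -/
def avgMeasure (d : ℕ) (M : NNReal) (R : ℝ) : Measure (Esp d × ℝ) :=
  M • (volume.restrict (Metric.closedBall (0 : Esp d) R)).prod
    (volume.restrict (Metric.closedBall (0 : ℝ) 2))

instance (d : ℕ) (M : NNReal) (R : ℝ) : IsFiniteMeasure (avgMeasure d M R) := by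
  have h1 : IsFiniteMeasure (volume.restrict (Metric.closedBall (0 : Esp d) R)) :=
    ⟨by rw [Measure.restrict_apply_univ]; exact measure_closedBall_lt_top⟩
  have h2 : IsFiniteMeasure (volume.restrict (Metric.closedBall (0 : ℝ) 2)) :=
    ⟨by rw [Measure.restrict_apply_univ]; exact measure_closedBall_lt_top⟩
  unfold avgMeasure
  infer_instance

theorem lintegral_avgMeasure (M : NNReal) (R : ℝ) {h : Esp d → ℝ → ℝ≥0∞}
    (hm : Measurable fun w : Esp d × ℝ => h w.1 w.2) :
    ∫⁻ w, h w.1 w.2 ∂avgMeasure d M R = ∫⁻ s, ∫⁻ z,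
      (M : ℝ≥0∞) * (Metric.closedBall (0 : Esp d) R).indicator (fun z =>
        (Metric.closedBall (0 : ℝ) 2).indicator (h z) s) z := by
  have hK : MeasurableSet (Metric.closedBall (0 : Esp d) R) :=
    Metric.isClosed_closedBall.measurableSet
  have hJ : MeasurableSet (Metric.closedBall (0 : ℝ) 2) := Metric.isClosed_closedBall.measurableSet
  have hM : ((M : NNReal) : ℝ≥0∞) ≠ ∞ := ENNReal.coe_ne_top
  rw [avgMeasure, lintegral_smul_measure, lintegral_prod_symm' _ hm, ← lintegral_indicator hJ,
    ENNReal.smul_def, smul_eq_mul, ← lintegral_const_mul' _ _ hM]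
  refine lintegral_congr fun s => ?_
  rw [lintegral_const_mul' _ _ hM, lintegral_indicator hK]
  by_cases hs : s ∈ Metric.closedBall (0 : ℝ) 2
  · simp only [indicator_of_mem hs]
  · simp only [indicator_of_notMem hs, lintegral_zero]

theorem enorm_S4_le {φ₁ : ℝ → ℝ} {φ₂ : Esp d → ℝ} {M₁ M₂ : NNReal} (hM₁ : ∀ s, ‖φ₁ s‖ₑ ≤ M₁)
    (hM₂ : ∀ z, ‖φ₂ z‖ₑ ≤ M₂) (h₁ : ∀ s, φ₁ s ≠ 0 → |s| < 1 / 2)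
    (h₂ : ∀ z, φ₂ z ≠ 0 → ‖z‖ < 1 / 2) {R : ℝ} (hR : ∀ u ∈ unitCell d, ‖u‖ + 1 / 2 ≤ R)
    {A : Set (Esp d × ℝ)} {ε : ℝ} (hε : 0 < ε) {g : Esp d → ℝ → Esp d → ℝ → ℝ} (hg : Meas4 g)
    (hA : MeasurableSet A) {x : Esp d} {t : ℝ}
    (hxt : ∀ z s, ‖z‖ < 1 / 2 → |s| < 1 / 2 → (x - ε • z, t - ε ^ 2 * s) ∈ A) {u : Esp d}
    (hu : u ∈ unitCell d) {v : ℝ} (hv : v ∈ Ioc (0 : ℝ) 1) (y : Esp d) (τ : ℝ) :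
    ‖S4 φ₁ φ₂ ε g x t y τ‖ₑ ≤ slidingMean (avgMeasure d (M₁ * M₂) R) ε (zeroExt A g)
      (x - ε • u) (t - ε ^ 2 * v) y τ := by
  set K := Metric.closedBall (0 : Esp d) R
  set J := Metric.closedBall (0 : ℝ) 2
  set M : ℝ≥0∞ := ((M₁ * M₂ : NNReal) : ℝ≥0∞) with hM
  set b : Esp d → ℝ → ℝ≥0∞ := fun z s => K.indicator (fun z => J.indicator (fun s =>
    zeroExt A g (x - ε • u - ε • z) (t - ε ^ 2 * v - ε ^ 2 * s) y τ) s) z with hb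
  rw [S4_eq_integral φ₁ φ₂ hε]
  calc _ ≤ ∫⁻ s : ℝ, (∫⁻ z, ‖g (x - ε • z) (t - ε ^ 2 * s) y τ‖ₑ * ‖φ₂ z‖ₑ) * ‖φ₁ s‖ₑ := by
        refine (enorm_integral_le_lintegral_enorm _).trans (lintegral_mono fun s => ?_)
        rw [enorm_mul]
        gcongr
        refine (enorm_integral_le_lintegral_enorm _).trans (lintegral_mono fun z => ?_)
        rw [enorm_mul]
    _ ≤ ∫⁻ s : ℝ, ∫⁻ z, M * b (z - u) (s - v) := by
        refine lintegral_mono fun s => ?_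
        rw [← lintegral_mul_const' _ _ enorm_ne_top]
        refine lintegral_mono fun z => ?_
        by_cases hs : φ₁ s = 0
        · simp [hs]
        by_cases hz : φ₂ z = 0
        · simp [hz]
        have hs' := h₁ s hs
        have hz' := h₂ z hz
        have hzK : z - u ∈ K := by
          rw [mem_closedBall_zero_iff]
          linarith [norm_sub_le z u, hR u hu]
        have hsJ : s - v ∈ J := by
          rw [mem_closedBall_zero_iff, Real.norm_eq_abs, abs_le]
          rw [abs_lt] at hs'
          constructor <;> linarith [hv.1, hv.2]
        have e1 : x - ε • u - ε • (z - u) = x - ε • z := by rw [smul_sub]; abel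
        have e2 : t - ε ^ 2 * v - ε ^ 2 * (s - v) = t - ε ^ 2 * s := by ring
        simp only [hb, hM, indicator_of_mem hzK, indicator_of_mem hsJ, e1, e2, zeroExt,
          indicator_of_mem (hxt z s hz' hs')]
        rw [mul_assoc, mul_comm, ENNReal.coe_mul, mul_comm (M₁ : ℝ≥0∞)]
        gcongr
        · exact hM₂ z
        · exact hM₁ s
    _ = ∫⁻ s : ℝ, ∫⁻ z, M * b z s := by
        rw [lintegral_sub_right_eq_self (fun s => ∫⁻ z, M * b (z - u) s)]
        refine lintegral_congr fun s => ?_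
        rw [lintegral_sub_right_eq_self (fun z => M * b z s)]
    _ = _ := by
        refine (lintegral_avgMeasure (M₁ * M₂) R
          (h := fun z s => zeroExt A g (x - ε • u - ε • z) (t - ε ^ 2 * v - ε ^ 2 * s) y τ)
          ?_).symm
        apply (MeasENN4.zeroExt hA hg).comp <;> fun_prop

theorem exists_enorm_le_of_hasCompactSupport {E : Type*} [TopologicalSpace E] {φ : E → ℝ}
    (hc : Continuous φ) (hs : HasCompactSupport φ) : ∃ M : NNReal, ∀ z, ‖φ z‖ₑ ≤ M := by
  obtain ⟨C, hC⟩ := hc.bounded_above_of_compact_support hs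
  refine ⟨C.toNNReal, fun z => ?_⟩
  rw [enorm_eq_nnnorm, ENNReal.coe_le_coe, ← NNReal.coe_le_coe, coe_nnnorm]
  exact (hC z).trans (Real.le_coe_toNNReal C)

theorem norm_add_half_le_of_mem_unitCell {u : Esp d} (hu : u ∈ unitCell d) :
    ‖u‖ + 1 / 2 ≤ d + 1 := by
  have h : ‖u‖ ^ 2 ≤ d := by
    rw [EuclideanSpace.norm_sq_eq]
    calc ∑ i, ‖u i‖ ^ 2 ≤ ∑ _i : Fin d, (1 : ℝ) := Finset.sum_le_sum fun i _ => by
          rw [Real.norm_eq_abs, sq_abs]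
          nlinarith [(hu i).1, (hu i).2]
      _ = d := by simp
  rcases Nat.eq_zero_or_pos d with rfl | hd
  · have : ‖u‖ = 0 := by simpa using h
    rw [this]; norm_num
  · have : (1 : ℝ) ≤ d := by exact_mod_cast hd
    nlinarith [norm_nonneg u]

theorem measurableSet_timeSpace {Ω : Set (Esp d)} (hΩ : IsOpen Ω) (T : ℝ) :
    MeasurableSet (timeSpace Ω T) := hΩ.measurableSet.prod measurableSet_Ioo

theorem measurableSet_blayer {Ω : Set (Esp d)} (hΩ : IsOpen Ω) (T k ε : ℝ) :
    MeasurableSet (blayer Ω T k ε) := by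
  have h : MeasurableSet {x ∈ Ω | Metric.infDist x Ωᶜ < k * ε} :=
    hΩ.measurableSet.inter
      (measurableSet_lt (Metric.continuous_infDist_pt _).measurable measurable_const)
  exact ((h.prod measurableSet_Ioo).union (hΩ.measurableSet.prod measurableSet_Ioo)).union
    (hΩ.measurableSet.prod measurableSet_Ioo)

theorem sub_mem_timeSpace_of_notMem_blayer {Ω : Set (Esp d)} {T ε : ℝ} (hε : 0 < ε) {x : Esp d}
    {t : ℝ} (h : (x, t) ∈ timeSpace Ω T \ blayer Ω T 1 ε) {z : Esp d} {s : ℝ} (hz : ‖z‖ < 1 / 2)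
    (hs : |s| < 1 / 2) : (x - ε • z, t - ε ^ 2 * s) ∈ timeSpace Ω T := by
  obtain ⟨⟨hx, ht⟩, hb⟩ := h
  simp only [blayer, one_mul, mem_union, mem_prod, mem_ofPred_eq, mem_Ioo, not_or, not_and,
    not_lt] at hb hx ht
  obtain ⟨⟨hb1, hb2⟩, hb3⟩ := hb
  have h2 : 0 < ε ^ 2 := pow_pos hε 2
  rw [abs_lt] at hs
  have ht1 : ε ^ 2 ≤ t := by
    by_contra! hc; exact absurd (hb2 hx ht.1) (not_le.2 hc)
  have ht2 : t ≤ T - ε ^ 2 := by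
    by_contra! hc; exact absurd (hb3 hx hc) (not_le.2 ht.2)
  have hd : ε ≤ Metric.infDist x Ωᶜ := by
    by_contra! hc; exact absurd (hb1 ⟨hx, hc⟩ ht.1) (not_le.2 ht.2)
  refine ⟨Metric.ball_infDist_compl_subset (x := x) ?_, ?_, ?_⟩
  · rw [Metric.mem_ball, dist_eq_norm, sub_sub_cancel_left, norm_neg, norm_smul,
      Real.norm_of_nonneg hε.le]
    nlinarith [norm_nonneg z]
  · dsimp only; nlinarith
  · dsimp only; nlinarith

theorem Per4.slidingMean_zeroExt {g : Esp d → ℝ → Esp d → ℝ → ℝ} (hg : Per4 g)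
    (A : Set (Esp d × ℝ)) (ρ : Measure (Esp d × ℝ)) (ε : ℝ) (x : Esp d) (t : ℝ) (y : Esp d)
    (τ : ℝ) :
    (∀ i, slidingMean ρ ε (zeroExt A g) x t (y + EuclideanSpace.single i 1) τ =
      slidingMean ρ ε (zeroExt A g) x t y τ) ∧
    slidingMean ρ ε (zeroExt A g) x t y (τ + 1) = slidingMean ρ ε (zeroExt A g) x t y τ := by
  simp [slidingMean, zeroExt, (hg _ _ _ _).1, (hg _ _ _ _).2]

end Smoothing

/-- Smoothing estimate for products, with explicit data for the kernels. -/
theorem mixNorm_osc4_S4_mul_S4_le {d : ℕ} {φ₁ : ℝ → ℝ} {φ₂ : Esp d → ℝ} {M₁ M₂ : NNReal}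
    (hM₁ : ∀ s, ‖φ₁ s‖ₑ ≤ M₁) (hM₂ : ∀ z, ‖φ₂ z‖ₑ ≤ M₂) (h₁ : ∀ s, φ₁ s ≠ 0 → |s| < 1 / 2)
    (h₂ : ∀ z, φ₂ z ≠ 0 → ‖z‖ < 1 / 2) {Ω : Set (Esp d)} (hΩ : IsOpen Ω) (T : ℝ)
    {p q p₁ p₂ q₁ q₂ r₁ r₂ s₁ s₂ s : ℝ≥0∞} (hp : 1 ≤ p) (hpt : p ≠ ∞) (hq : 1 ≤ q) (hqt : q ≠ ∞)
    (hp₁ : 1 ≤ p₁) (hp₂ : 1 ≤ p₂) (hq₁ : 1 ≤ q₁) (hq₂ : 1 ≤ q₂)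
    (hr₁ : 1 ≤ r₁) (hr₂ : 1 ≤ r₂) (hs₁ : 1 ≤ s₁) (hs₂ : 1 ≤ s₂)
    (hp' : 1 / p = 1 / p₁ + 1 / p₂) (hr' : 1 / p = 1 / r₁ + 1 / r₂)
    (hq' : 1 / q = 1 / q₁ + 1 / q₂) (hs' : 1 / s = 1 / s₁ + 1 / s₂)
    (hps : p ≤ s) (hqs : q ≤ s) {g f : Esp d → ℝ → Esp d → ℝ → ℝ}
    (hg : Meas4 g) (hf : Meas4 f) (hgp : Per4 g) (hfp : Per4 f) {ε : ℝ} (hε : 0 < ε) :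
    mixNorm q p (timeSpace Ω T \ blayer Ω T 1 ε)
        (fun x t => (‖osc4 ε (fun x' t' y τ =>
          S4 φ₁ φ₂ ε g x' t' y τ * S4 φ₁ φ₂ ε f x' t' y τ) x t‖₊ : ℝ≥0∞)) ≤
      avgMeasure d (M₁ * M₂) (d + 1) univ ^ 2 *
        mixNorm q₁ p₁ (timeSpace Ω T) (fun x t => cellNorm s₁ r₁ (g x t)) *
        mixNorm q₂ p₂ (timeSpace Ω T) (fun x t => cellNorm s₂ r₂ (f x t)) := by
  set A := timeSpace Ω T
  set B := A \ blayer Ω T 1 ε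
  set ρ := avgMeasure d (M₁ * M₂) (d + 1)
  have hA : MeasurableSet A := measurableSet_timeSpace hΩ T
  have hB : MeasurableSet B := hA.diff (measurableSet_blayer hΩ T 1 ε)
  have mg : MeasENN4 (zeroExt A g) := MeasENN4.zeroExt hA hg
  have mf : MeasENN4 (zeroExt A f) := MeasENN4.zeroExt hA hf
  have mG := mg.slidingMean ρ ε
  have mF := mf.slidingMean ρ ε
  have hper := fun x t y τ => hgp.slidingMean_zeroExt A ρ ε x t y τ
  have fper := fun x t y τ => hfp.slidingMean_zeroExt A ρ ε x t y τ
  calc _ = eLp q volume fun t => eLp p volume fun x => {x | (x, t) ∈ B}.indicator (fun x =>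
          ‖osc4 ε (fun x' t' y τ =>
            S4 φ₁ φ₂ ε g x' t' y τ * S4 φ₁ φ₂ ε f x' t' y τ) x t‖ₑ) x := by
        unfold mixNorm
        congr 1 with t
        exact eLp_restrict hp _ (measurable_prodMk_right hB) _
    _ ≤ _ := by
        refine eLp_eLp_le_of_periodic hp hpt hq hqt hε (mG.mul mF)
          (fun x t y τ i => by rw [(hper x t y τ).1 i, (fper x t y τ).1 i])
          (fun x t y τ => by rw [(hper x t y τ).2, (fper x t y τ).2]) fun x t u hu v hv => ?_
        by_cases hx : (x, t) ∈ B
        · rw [indicator_of_mem (by exact hx), osc4, enorm_mul]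
          have hxt := fun z s (hz : ‖z‖ < 1 / 2) (hs : |s| < 1 / 2) =>
            sub_mem_timeSpace_of_notMem_blayer hε hx hz hs
          exact mul_le_mul'
            (enorm_S4_le hM₁ hM₂ h₁ h₂ (fun u hu => norm_add_half_le_of_mem_unitCell hu) hε hg hA
              hxt hu hv _ _)
            (enorm_S4_le hM₁ hM₂ h₁ h₂ (fun u hu => norm_add_half_le_of_mem_unitCell hu) hε hf hA
              hxt hu hv _ _)
        · rw [indicator_of_notMem (by exact hx)]; exact bot_le
    _ ≤ mixNorm4 q₁ p₁ s₁ r₁ (slidingMean ρ ε (zeroExt A g)) *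
          mixNorm4 q₂ p₂ s₂ r₂ (slidingMean ρ ε (zeroExt A f)) :=
        eLp_mul_le_mixNorm4_mul hp hpt hq hp₁ hp₂ hq₁ hq₂ hr₁ hr₂ hs₁ hs₂ hp' hr' hq' hs' hps hqs
          mG mF
    _ ≤ (ρ univ * mixNorm4 q₁ p₁ s₁ r₁ (zeroExt A g)) *
          (ρ univ * mixNorm4 q₂ p₂ s₂ r₂ (zeroExt A f)) :=
        mul_le_mul' (mixNorm4_slidingMean_le hq₁ hp₁ hs₁ hr₁ ρ ε mg)
          (mixNorm4_slidingMean_le hq₂ hp₂ hs₂ hr₂ ρ ε mf)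
    _ = _ := by
        rw [mixNorm4_zeroExt hA hp₁ hs₁ hr₁, mixNorm4_zeroExt hA hp₂ hs₂ hr₂]
        ring

theorem S4_one {d : ℕ} {φ₁ : ℝ → ℝ} {φ₂ : Esp d → ℝ} (h₁ : ∫ s, φ₁ s = 1) (h₂ : ∫ z, φ₂ z = 1)
    {ε : ℝ} (hε : 0 < ε) (x : Esp d) (t : ℝ) (y : Esp d) (τ : ℝ) :
    S4 φ₁ φ₂ ε (fun _ _ _ _ => 1) x t y τ = 1 := by
  rw [S4_eq_integral φ₁ φ₂ hε]
  simp [h₁, h₂]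

theorem mixNorm_cellNorm_one_le {d : ℕ} (A : Set (Esp d × ℝ)) :
    mixNorm ∞ ∞ A (fun _ _ => cellNorm ∞ ∞ (fun (_ : Esp d) (_ : ℝ) => (1 : ℝ))) ≤ 1 := by
  have h : ∀ {α : Type} [MeasurableSpace α] (μ : Measure α) {f : α → ℝ≥0∞},
      (∀ x, f x ≤ 1) → eLp ∞ μ f ≤ 1 := by
    intro α _ μ f hf
    rw [eLp_top]
    exact essSup_le_of_ae_le _ (Filter.Eventually.of_forall hf)
  exact h _ fun t => h _ fun x => h _ fun τ => h _ fun y => by simp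

/-- Lemma on smoothing of products, both parts. -/
theorem stmt_2 (d : ℕ) (φ₁ : ℝ → ℝ) (φ₂ : Esp d → ℝ) (hφ₁ : GoodK1 φ₁) (hφ₂ : GoodK2 φ₂) :
    ∃ C : ℝ≥0∞, C ≠ ∞ ∧
      ((∀ (Ω : Set (Esp d)), IsOpen Ω → Bornology.IsBounded Ω → ∀ T : ℝ, 0 < T →
        ∀ p q p₁ p₂ q₁ q₂ r₁ r₂ s₁ s₂ s : ℝ≥0∞,
          1 ≤ p → p ≠ ∞ → 1 ≤ q → q ≠ ∞ →
          1 ≤ p₁ → 1 ≤ p₂ → 1 ≤ q₁ → 1 ≤ q₂ → 1 ≤ r₁ → 1 ≤ r₂ → 1 ≤ s₁ → 1 ≤ s₂ →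
          1/p₁ + 1/p₂ = 1/p → 1/r₁ + 1/r₂ = 1/p → 1/q₁ + 1/q₂ = 1/q →
          1/s = 1/s₁ + 1/s₂ → p ≤ s → q ≤ s →
          ∀ g f : Esp d → ℝ → Esp d → ℝ → ℝ,
            Meas4 g → Meas4 f → Per4 g → Per4 f →
            mixNorm q₁ p₁ univ (fun x t => cellNorm s₁ r₁ (g x t)) < ∞ →
            mixNorm q₂ p₂ univ (fun x t => cellNorm s₂ r₂ (f x t)) < ∞ →
            ∀ ε : ℝ, 0 < ε →
              mixNorm q p (timeSpace Ω T \ blayer Ω T 1 ε)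
                  (fun x t => (‖osc4 ε (fun x' t' y τ =>
                      S4 φ₁ φ₂ ε g x' t' y τ * S4 φ₁ φ₂ ε f x' t' y τ) x t‖₊ : ℝ≥0∞)) ≤
                C * mixNorm q₁ p₁ (timeSpace Ω T) (fun x t => cellNorm s₁ r₁ (g x t)) *
                  mixNorm q₂ p₂ (timeSpace Ω T) (fun x t => cellNorm s₂ r₂ (f x t))) ∧
      (∀ (Ω : Set (Esp d)), IsOpen Ω → Bornology.IsBounded Ω → ∀ T : ℝ, 0 < T →
        ∀ p q s : ℝ≥0∞,
          1 ≤ p → p ≠ ∞ → 1 ≤ q → q ≠ ∞ → p ≤ s → q ≤ s →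
          ∀ g : Esp d → ℝ → Esp d → ℝ → ℝ,
            Meas4 g → Per4 g →
            mixNorm q p univ (fun x t => cellNorm s p (g x t)) < ∞ →
            ∀ ε : ℝ, 0 < ε →
              mixNorm q p (timeSpace Ω T \ blayer Ω T 1 ε)
                  (fun x t => (‖osc4 ε (S4 φ₁ φ₂ ε g) x t‖₊ : ℝ≥0∞)) ≤
                C * mixNorm q p (timeSpace Ω T) (fun x t => cellNorm s p (g x t)))) := by
  obtain ⟨c₁, k₁, t₁, -, i₁⟩ := hφ₁
  obtain ⟨c₂, k₂, t₂, -, i₂⟩ := hφ₂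
  obtain ⟨M₁, hM₁⟩ := exists_enorm_le_of_hasCompactSupport c₁.continuous k₁
  obtain ⟨M₂, hM₂⟩ := exists_enorm_le_of_hasCompactSupport c₂.continuous k₂
  have h₁ : ∀ s, φ₁ s ≠ 0 → |s| < 1 / 2 := fun s hs =>
    abs_lt.2 (t₁ (subset_tsupport φ₁ hs))
  have h₂ : ∀ z, φ₂ z ≠ 0 → ‖z‖ < 1 / 2 := fun z hz =>
    mem_ball_zero_iff.1 (t₂ (subset_tsupport φ₂ hz))
  refine ⟨avgMeasure d (M₁ * M₂) (d + 1) univ ^ 2, ENNReal.pow_ne_top (measure_ne_top _ _),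
    ?_, ?_⟩
  · intro Ω hΩ _ T _ p q p₁ p₂ q₁ q₂ r₁ r₂ s₁ s₂ s hp hpt hq hqt hp₁ hp₂ hq₁ hq₂ hr₁ hr₂ hs₁ hs₂
      hp' hr' hq' hs' hps hqs g f hg hf hgp hfp _ _ ε hε
    exact mixNorm_osc4_S4_mul_S4_le hM₁ hM₂ h₁ h₂ hΩ T hp hpt hq hqt hp₁ hp₂ hq₁ hq₂ hr₁ hr₂ hs₁
      hs₂ hp'.symm hr'.symm hq'.symm hs' hps hqs hg hf hgp hfp hε
  · intro Ω hΩ _ T _ p q s hp hpt hq hqt hps hqs g hg hgp _ ε hε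
    have key := mixNorm_osc4_S4_mul_S4_le (p₂ := ∞) (q₂ := ∞) (r₂ := ∞) (s₂ := ∞) hM₁ hM₂ h₁ h₂
      hΩ T hp hpt hq hqt hp le_top hq le_top hp le_top (hp.trans hps) le_top (by simp) (by simp)
      (by simp) (by simp) hps hqs hg (f := fun _ _ _ _ => 1) measurable_const hgp
      (fun _ _ _ _ => ⟨fun _ => rfl, rfl⟩) hε
    simp only [S4_one i₁ i₂ hε, mul_one] at key
    exact key.trans (mul_le_of_le_one_right' (mixNorm_cellNorm_one_le _))

end
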